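/- (Pseudo-polynomial bound on interval lengths for the multi-mode demand bound test.) Consider a finite mixed-criticality task set containing tasks of criticality level m−1 (indexed i ∈ I₁) and tasks of criticality level at least m (indexed i ∈ I₂), each with its own parameters and per-task total demand function DEM_i as defined below. Let U = Σ_{i∈I₂} C_i'''/T_i, A = Σ_{i∈I₁} C_i''/T_i + Σ_{i∈I₂} (C_i'' − C_i''')/T_i, and B = Σ_{i∈I₁} 2·C_i'' + Σ_{i∈I₂} ( 2·C_i''' + (T_i − D_i''')·C_i'''/T_i ). If U + max(A, 0) < 1, then for all reals e and S with 0 ≤ S ≤ e and all release offsets r_i ∈ [−T_i, 0], Σ_i DEM_i(r_i) > e implies e < B / (1 − U − max(A, 0)); hence any violation of the multi-mode demand condition occurs at an interval length bounded by B/(1 − U − max(A,0)). -/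

import Mathlib

/-- Demand in `[0, e)` of the carry-over job `J^A` (active at the switch into
level-(m−1) mode at time 0) of a level-(m−1) task, released at time `r`. -/
noncomputable def Adem (C' C'' D' D'' e S r : ℝ) : ℝ :=
  if 0 ≤ r + D' ∧ r + D'' ≤ e then min (min (r + D') C' + C'' - C') S else 0

/-- Demand in `[0, e)` of the carry-over job `J^B` (active at the switch into
level-m mode at time `S`) of a level-(m−1) task, released at time `s`. -/
noncomputable def Bdem (C'' D'' e S s : ℝ) : ℝ :=
  if s + D'' ≤ e then min C'' (S - s) else 0

/-- Total demand of a level-(m−1) task in `[0, e)` when its carry-over job `J^A`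
is released at time `r` and all subsequent jobs are released as early as
possible (every `T` time units). -/
noncomputable def DEM₁ (T C' C'' D' D'' e S r : ℝ) : ℝ :=
  if S < r + T then Adem C' C'' D' D'' e S r
  else Adem C' C'' D' D'' e S r
    + ((⌊(S - r - T) / T⌋ : ℤ) : ℝ) * C''
    + Bdem C'' D'' e S (r + (((⌊(S - r - T) / T⌋ : ℤ) : ℝ) + 1) * T)

/-- Demand in `[0, e)` of the carry-over job `J^C` (active at the switch into
level-(m−1) mode at time 0) of a level-≥m task, released at time `r`. -/
noncomputable def Cdem (C' C'' C''' D' D'' D''' e S r : ℝ) : ℝ :=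
  if r + D' < 0 ∨ e < r + D'' then 0
  else if r + D'' < S then C'' - C' + min (r + D') C'
  else if r + D''' ≤ e then C''' - C' + min (r + D') C'
  else min S (C'' - C' + min (r + D') C')

/-- Demand in `[0, e)` of the carry-over job `J^D` (active at the switch into
level-m mode at time `S`) of a level-≥m task, released at time `s`. -/
noncomputable def Ddem (C'' C''' D'' D''' e S s : ℝ) : ℝ :=
  if e < s + D'' then 0
  else if s + D'' < S then C''
  else if s + D''' ≤ e then C'''
  else min C'' (S - s)

/-- Total demand of a level-≥m task in `[0, e)` when its carry-over job `J^C`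
is released at time `r` and all subsequent jobs are released as early as
possible (every `T` time units). -/
noncomputable def DEM₂ (T C' C'' C''' D' D'' D''' e S r : ℝ) : ℝ :=
  if S < r + T then
    Cdem C' C'' C''' D' D'' D''' e S r
      + ((max 0 (⌊(e - (r + T) - D''') / T⌋ + 1) : ℤ) : ℝ) * C'''
  else
    Cdem C' C'' C''' D' D'' D''' e S r
      + ((⌊(S - r - T) / T⌋ : ℤ) : ℝ) * C''
      + Ddem C'' C''' D'' D''' e S (r + (((⌊(S - r - T) / T⌋ : ℤ) : ℝ) + 1) * T)
      + ((max 0 (⌊(e - (r + (((⌊(S - r - T) / T⌋ : ℤ) : ℝ) + 2) * T) - D''') / T⌋ + 1) : ℤ) : ℝ)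
          * C'''

theorem Adem_le {C' C'' D' D'' e S r : ℝ} (hC : 0 ≤ C'') : Adem C' C'' D' D'' e S r ≤ C'' := by
  unfold Adem
  split_ifs
  · linarith [min_le_left (min (r + D') C' + C'' - C') S, min_le_right (r + D') C']
  · exact hC

theorem Bdem_le {C'' D'' e S s : ℝ} (hC : 0 ≤ C'') : Bdem C'' D'' e S s ≤ C'' := by
  unfold Bdem
  split_ifs
  · exact min_le_left _ _
  · exact hC

theorem Cdem_le {C' C'' C''' D' D'' D''' e S r : ℝ} (hC : 0 ≤ C'') (hCC : C'' ≤ C''') :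
    Cdem C' C'' C''' D' D'' D''' e S r ≤ C''' := by
  have hmin := min_le_right (r + D') C'
  unfold Cdem
  split_ifs
  · linarith
  · linarith
  · linarith
  · linarith [min_le_right S (C'' - C' + min (r + D') C')]

theorem Ddem_le {C'' C''' D'' D''' e S s : ℝ} (hC : 0 ≤ C'') (hCC : C'' ≤ C''') :
    Ddem C'' C''' D'' D''' e S s ≤ C''' := by
  unfold Ddem
  split_ifs
  · linarith
  · exact hCC
  · exact le_rfl
  · exact (min_le_left _ _).trans hCC

/-- The demand of a level-(m−1) task is at most two jobs plus its utilization over `[0, S)`. -/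
theorem DEM₁_le {T C' C'' D' D'' e S r : ℝ} (hT : 0 < T) (hC : 0 ≤ C'') (hS : 0 ≤ S)
    (hr : -T ≤ r) : DEM₁ T C' C'' D' D'' e S r ≤ 2 * C'' + S * (C'' / T) := by
  have hA := Adem_le (C' := C') (D' := D') (D'' := D'') (e := e) (S := S) (r := r) hC
  unfold DEM₁
  split_ifs
  · have : 0 ≤ S * (C'' / T) := by positivity
    linarith
  · have hB := Bdem_le (D'' := D'') (e := e) (S := S)
      (s := r + (((⌊(S - r - T) / T⌋ : ℤ) : ℝ) + 1) * T) hC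
    have hn : ((⌊(S - r - T) / T⌋ : ℤ) : ℝ) ≤ S / T :=
      (Int.floor_le _).trans (by gcongr; linarith)
    have hnC := mul_le_mul_of_nonneg_right hn hC
    rw [div_mul_eq_mul_div, mul_div_assoc] at hnC
    linarith

theorem max_zero_floor_add_one_eq_zero_or_le (x : ℝ) :
    ((max 0 (⌊x⌋ + 1) : ℤ) : ℝ) = 0 ∨ ((max 0 (⌊x⌋ + 1) : ℤ) : ℝ) ≤ x + 1 := by
  rcases max_choice 0 (⌊x⌋ + 1) with h | h
  · left
    rw [h, Int.cast_zero]
  · right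
    rw [h]
    push_cast
    linarith [Int.floor_le x]

/-- The demand of a level-≥m task is bounded by its utilizations over `[0, S)` and `[S, e)`, up
to two jobs and the slack between deadline and period. -/
theorem DEM₂_le {T C' C'' C''' D' D'' D''' e S r : ℝ} (hT : 0 < T) (hC : 0 ≤ C'')
    (hCC : C'' ≤ C''') (hD : D''' ≤ T) (hS : 0 ≤ S) (hSe : S ≤ e) (hr : -T ≤ r) :
    DEM₂ T C' C'' C''' D' D'' D''' e S r ≤
      (2 * C''' + (T - D''') * C''' / T) + S * ((C'' - C''') / T) + e * (C''' / T) := by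
  have hCdem := Cdem_le (C' := C') (D' := D') (D'' := D'') (D''' := D''') (e := e) (S := S)
    (r := r) hC hCC
  obtain ⟨u, rfl⟩ : ∃ u, C'' = u * T := ⟨C'' / T, by field_simp⟩
  obtain ⟨v, rfl⟩ : ∃ v, C''' = v * T := ⟨C''' / T, by field_simp⟩
  have hu : 0 ≤ u := nonneg_of_mul_nonneg_left hC hT
  have huv : u ≤ v := le_of_mul_le_mul_right hCC hT
  have hv : 0 ≤ v := hu.trans huv
  have hbound : (2 * (v * T) + (T - D''') * (v * T) / T) + S * ((u * T - v * T) / T)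
      + e * (v * T / T) = 2 * (v * T) + (T - D''') * v + S * u + (e - S) * v := by
    field_simp
    ring
  rw [hbound]
  have hvT : 0 ≤ v * T := mul_nonneg hv hT.le
  have hslack : 0 ≤ (T - D''') * v := mul_nonneg (sub_nonneg.2 hD) hv
  have hSu : 0 ≤ S * u := mul_nonneg hS hu
  have heS : 0 ≤ (e - S) * v := mul_nonneg (sub_nonneg.2 hSe) hv
  unfold DEM₂
  split_ifs with h
  · rcases max_zero_floor_add_one_eq_zero_or_le ((e - (r + T) - D''') / T) with hk | hk
    · rw [hk]
      linarith
    · have hkC := mul_le_mul_of_nonneg_right hk hvT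
      have hk' : ((e - (r + T) - D''') / T + 1) * (v * T) = (e - r - D''') * v := by
        field_simp
        ring
      have hrel : 0 ≤ (r + T - S) * v := mul_nonneg (sub_nonneg.2 h.le) hv
      linarith
  · set n : ℝ := ((⌊(S - r - T) / T⌋ : ℤ) : ℝ)
    have hn₁ : n * T ≤ S - r - T := (le_div_iff₀ hT).1 (Int.floor_le _)
    have hn₂ : S - r - T < (n + 1) * T := (div_lt_iff₀ hT).1 (Int.lt_floor_add_one _)
    have hDdem := Ddem_le (D'' := D'') (D''' := D''') (e := e) (S := S) (s := r + (n + 1) * T)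
      hC hCC
    have hnu : n * T * u ≤ S * u := mul_le_mul_of_nonneg_right (by linarith) hu
    rcases max_zero_floor_add_one_eq_zero_or_le ((e - (r + (n + 2) * T) - D''') / T) with hk | hk
    · rw [hk]
      linarith
    · have hkC := mul_le_mul_of_nonneg_right hk hvT
      have hk' : ((e - (r + (n + 2) * T) - D''') / T + 1) * (v * T)
          = (e - (r + (n + 1) * T) - D''') * v := by
        field_simp
        ring
      have hgap : (S - r - T - n * T) * (v - u) ≤ T * (v - u) :=
        mul_le_mul_of_nonneg_right (by linarith) (sub_nonneg.2 huv)
      have hru : 0 ≤ (r + T) * u := mul_nonneg (by linarith) hu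
      have huT : 0 ≤ T * u := mul_nonneg hT.le hu
      linarith

/-- Pseudo-polynomial bound on interval lengths for the multi-mode demand bound
test: for a task set with level-(m−1) tasks (index `I₁`) and level-≥m tasks
(index `I₂`), if `U + max(A, 0) < 1`, then any violation of the multi-mode
demand condition occurs at an interval length `e < B / (1 − U − max(A, 0))`. -/
theorem multi_mode_test_pseudo_polynomial_bound
    {I₁ I₂ : Type} [Fintype I₁] [Fintype I₂]
    (T₁ C₁' C₁'' D₁' D₁'' : I₁ → ℝ)
    (T₂ C₂' C₂'' C₂''' D₂' D₂'' D₂''' : I₂ → ℝ)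
    (h₁ : ∀ i, 0 < T₁ i ∧ 0 < C₁' i ∧ C₁' i ≤ C₁'' i ∧ C₁' i ≤ D₁' i ∧
      C₁'' i ≤ D₁'' i ∧ D₁' i ≤ D₁'' i ∧ D₁'' i ≤ T₁ i)
    (h₂ : ∀ i, 0 < T₂ i ∧ 0 < C₂' i ∧ C₂' i ≤ C₂'' i ∧ C₂'' i ≤ C₂''' i ∧
      C₂' i ≤ D₂' i ∧ C₂'' i ≤ D₂'' i ∧ C₂''' i ≤ D₂''' i ∧
      D₂' i ≤ D₂'' i ∧ D₂'' i ≤ D₂''' i ∧ D₂''' i ≤ T₂ i)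
    (U A B : ℝ)
    (hU : U = ∑ i, C₂''' i / T₂ i)
    (hA : A = (∑ i, C₁'' i / T₁ i) + ∑ i, (C₂'' i - C₂''' i) / T₂ i)
    (hB : B = (∑ i, 2 * C₁'' i) + ∑ i, (2 * C₂''' i + (T₂ i - D₂''' i) * C₂''' i / T₂ i))
    (hlt : U + max A 0 < 1) :
    ∀ e S : ℝ, 0 ≤ S → S ≤ e →
      ∀ r₁ : I₁ → ℝ, ∀ r₂ : I₂ → ℝ,
        (∀ i, -T₁ i ≤ r₁ i ∧ r₁ i ≤ 0) →
        (∀ i, -T₂ i ≤ r₂ i ∧ r₂ i ≤ 0) →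
        (∑ i, DEM₁ (T₁ i) (C₁' i) (C₁'' i) (D₁' i) (D₁'' i) e S (r₁ i)) +
          (∑ i, DEM₂ (T₂ i) (C₂' i) (C₂'' i) (C₂''' i) (D₂' i) (D₂'' i) (D₂''' i) e S (r₂ i))
          > e →
        e < B / (1 - U - max A 0) := by
  intro e S hS hSe r₁ r₂ hr₁ hr₂ hdem
  have hsum₁ := Finset.sum_le_sum fun i (_ : i ∈ Finset.univ) =>
    DEM₁_le (C' := C₁' i) (D' := D₁' i) (D'' := D₁'' i) (e := e) (h₁ i).1
      ((h₁ i).2.1.le.trans (h₁ i).2.2.1) hS (hr₁ i).1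
  have hsum₂ := Finset.sum_le_sum fun i (_ : i ∈ Finset.univ) =>
    have ⟨hT, hC', hC'', hC''', _, _, _, _, _, hD'''⟩ := h₂ i
    DEM₂_le (C' := C₂' i) (D' := D₂' i) (D'' := D₂'' i) hT (hC'.le.trans hC'') hC''' hD''' hS hSe
      (hr₂ i).1
  rw [Finset.sum_add_distrib, ← Finset.mul_sum Finset.univ (fun i => C₁'' i / T₁ i)] at hsum₁
  rw [Finset.sum_add_distrib, Finset.sum_add_distrib, ← Finset.mul_sum, ← Finset.mul_sum,
    ← hU] at hsum₂
  have hSA : S * A ≤ e * max A 0 :=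
    (mul_le_mul_of_nonneg_left (le_max_left A 0) hS).trans
      (mul_le_mul_of_nonneg_right hSe (le_max_right A 0))
  have hSA' : S * A = S * (∑ i, C₁'' i / T₁ i) + S * ∑ i, (C₂'' i - C₂''' i) / T₂ i := by
    rw [hA, mul_add]
  rw [lt_div_iff₀ (by linarith)]
  linarith
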